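/- There exist real constants A > 0 and ε > 0 such that for every function k : ℕ → ℕ satisfying k(n) ≤ n for all n and lim_{n→∞} ( n²/4 − ε·n + A·√n − k(n)·(n − k(n)) ) = −∞ (condition (⋆)), the ratio N^M_{k(n),n} / N^M_n between the number of monomial equivalence classes of k(n)-dimensional linear codes in F_q^n and the total number of monomial equivalence classes of linear codes in F_q^n satisfies N^M_{k(n),n} / N^M_n ∼ p(k(n), n) := binom(n, k(n))_q / S(n) as n → ∞. -/

import Mathlib

open Filter Matrix
open scoped Topology

/-- The `q`-binomial coefficient `binom(n,k)_q = ∏_{j=0}^{k-1} (q^{n-j}-1)/(q^{k-j}-1)`. -/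
noncomputable def qBinom (q n k : ℕ) : ℝ :=
  ∏ j ∈ Finset.range k, ((q : ℝ) ^ (n - j) - 1) / ((q : ℝ) ^ (k - j) - 1)

/-- `S(n) = ∑_{k=0}^n binom(n,k)_q`. -/
noncomputable def Sq (q n : ℕ) : ℝ := ∑ k ∈ Finset.range (n + 1), qBinom q n k

/-- `K_q = ∏_{j=1}^∞ (1 - q^{-j})`. -/
noncomputable def Kq (q : ℕ) : ℝ := ∏' j : ℕ, (1 - ((q : ℝ))⁻¹ ^ (j + 1))

/-- `K_q(k) = ∏_{j=1}^{k} (1 - q^{-j})`. -/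
noncomputable def KqTrunc (q k : ℕ) : ℝ := ∏ j ∈ Finset.range k, (1 - ((q : ℝ))⁻¹ ^ (j + 1))

/-- Jacobi theta constant `θ₂(w) = ∑_{k∈ℤ} w^{(k+1/2)²}`. -/
noncomputable def theta2 (w : ℝ) : ℝ := ∑' k : ℤ, w ^ (((k : ℝ) + 1/2) ^ 2)

/-- Jacobi theta constant `θ₃(w) = ∑_{k∈ℤ} w^{k²}`. -/
noncomputable def theta3 (w : ℝ) : ℝ := ∑' k : ℤ, w ^ ((k : ℝ) ^ 2)

/-- Condition (⋆): `n²/4 − ε·n + A·√n − k(n)(n−k(n)) → −∞`. -/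
def StarCond (A ε : ℝ) (k : ℕ → ℕ) : Prop :=
  Tendsto (fun n : ℕ =>
    (n : ℝ) ^ 2 / 4 - ε * n + A * Real.sqrt n - (k n : ℝ) * ((n : ℝ) - (k n : ℝ)))
    atTop atBot

/-- The set of permutation matrices inside `GL n F`. -/
def permSet (F : Type) [Field F] (n : ℕ) : Set (GL (Fin n) F) :=
  {M | ∃ σ : Equiv.Perm (Fin n), (M : Matrix (Fin n) (Fin n) F) = σ.permMatrix F}

/-- The set of invertible diagonal matrices inside `GL n F`. -/
def diagSet (F : Type) [Field F] (n : ℕ) : Set (GL (Fin n) F) :=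
  {M | ∃ d : Fin n → F, (M : Matrix (Fin n) (Fin n) F) = Matrix.diagonal d}

/-- The permutation group: subgroup of `GL n F` formed by the permutation matrices. -/
def PermGroup (F : Type) [Field F] (n : ℕ) : Subgroup (GL (Fin n) F) :=
  Subgroup.closure (permSet F n)

/-- The monomial group: subgroup of `GL n F` generated by permutation and diagonal matrices. -/
def MonomialGroup (F : Type) [Field F] (n : ℕ) : Subgroup (GL (Fin n) F) :=
  Subgroup.closure (permSet F n ∪ diagSet F n)

/-- Number of orbits of a subgroup `G ≤ GL n F` acting on the Grassmannian of
`k`-dimensional subspaces of `F^n` (by taking images of subspaces). -/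
noncomputable def numClassesDim {n : ℕ} (F : Type) [Field F]
    (G : Subgroup (GL (Fin n) F)) (k : ℕ) : ℕ :=
  Nat.card (Quot (fun V W : {V : Submodule F (Fin n → F) // Module.finrank F V = k} =>
    ∃ M ∈ G, Submodule.map (Matrix.toLin' (M : Matrix (Fin n) (Fin n) F)) V.1 = W.1))

/-- Number of orbits of a subgroup `G ≤ GL n F` acting on the set of all subspaces of `F^n`. -/
noncomputable def numClasses {n : ℕ} (F : Type) [Field F]
    (G : Subgroup (GL (Fin n) F)) : ℕ :=
  Nat.card (Quot (fun V W : Submodule F (Fin n → F) =>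
    ∃ M ∈ G, Submodule.map (Matrix.toLin' (M : Matrix (Fin n) (Fin n) F)) V = W))

/-- Semilinear orbit relation: `W` is the image of `V` under the semilinear transformation
given by applying the field automorphism `σ` componentwise followed by a monomial matrix. -/
def semiRel (F : Type) [Field F] (n : ℕ) (V W : Submodule F (Fin n → F)) : Prop :=
  ∃ σ : F ≃+* F, ∃ M ∈ MonomialGroup F n,
    (W : Set (Fin n → F)) =
      (fun x => Matrix.mulVec (M : Matrix (Fin n) (Fin n) F) (fun i => σ (x i))) '' (V : Set (Fin n → F))

/-- Number of semilinear equivalence classes of `k`-dimensional subspaces of `F^n`. -/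
noncomputable def numClassesDimSemi (F : Type) [Field F] (n k : ℕ) : ℕ :=
  Nat.card (Quot (fun V W : {V : Submodule F (Fin n → F) // Module.finrank F V = k} =>
    semiRel F n V.1 W.1))

/-- Number of semilinear equivalence classes of subspaces of `F^n`. -/
noncomputable def numClassesSemi (F : Type) [Field F] (n : ℕ) : ℕ :=
  Nat.card (Quot (fun V W : Submodule F (Fin n → F) => semiRel F n V W))

/-! ### Counting subspaces -/

section SubspaceCount

variable {F : Type} [Field F]
variable {V : Type} [AddCommGroup V] [Module F V] [Finite V]

/-- Linearly independent `k`-tuples with a prescribed `k`-dimensional span are the same as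
linearly independent `k`-tuples inside that span. -/
noncomputable def linearIndependentSpanEquiv {k : ℕ} (U : Submodule F V)
    (hU : Module.finrank F U = k) :
    {s : {s : Fin k → V // LinearIndependent F s} //
      Submodule.span F (Set.range s.1) = U} ≃ {s : Fin k → U // LinearIndependent F s} where
  toFun s := ⟨fun i => ⟨s.1.1 i, s.2.le (Submodule.subset_span ⟨i, rfl⟩)⟩,
    LinearIndependent.of_comp U.subtype s.1.2⟩
  invFun s := ⟨⟨fun i => s.1 i, s.2.map' U.subtype (Submodule.ker_subtype U)⟩, by
    have hli : LinearIndependent F (fun i => (s.1 i : V)) :=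
      s.2.map' U.subtype (Submodule.ker_subtype U)
    apply Submodule.eq_of_le_of_finrank_eq
    · rw [Submodule.span_le]
      rintro _ ⟨i, rfl⟩
      exact (s.1 i).2
    · rw [finrank_span_eq_card hli, hU, Fintype.card_fin]⟩
  left_inv s := rfl
  right_inv s := rfl

theorem card_submodule_eq_sum :
    Nat.card (Submodule F V) = ∑ k ∈ Finset.range (Module.finrank F V + 1),
      Nat.card {U : Submodule F V // Module.finrank F U = k} := by
  classical
  have : Fintype (Submodule F V) := Fintype.ofFinite _
  simp only [Nat.card_eq_fintype_card, Fintype.card_subtype]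
  exact Finset.card_eq_sum_card_fiberwise fun U _ =>
    Finset.mem_coe.2 (Finset.mem_range_succ_iff.2 (Submodule.finrank_le U))

variable [Fintype F]

theorem card_grassmannian_mul {k : ℕ} (hk : k ≤ Module.finrank F V) :
    Nat.card {U : Submodule F V // Module.finrank F U = k} *
        ∏ i : Fin k, (Fintype.card F ^ k - Fintype.card F ^ i.val) =
      ∏ i : Fin k, (Fintype.card F ^ Module.finrank F V - Fintype.card F ^ i.val) := by
  classical
  rw [← card_linearIndependent (V := V) hk]
  let f : {s : Fin k → V // LinearIndependent F s} →
      {U : Submodule F V // Module.finrank F U = k} :=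
    fun s => ⟨Submodule.span F (Set.range s.1), by
      rw [finrank_span_eq_card s.2, Fintype.card_fin]⟩
  have : Fintype {U : Submodule F V // Module.finrank F U = k} := Fintype.ofFinite _
  rw [← Nat.card_congr (Equiv.sigmaFiberEquiv f), Nat.card_sigma, Nat.card_eq_fintype_card]
  have h : ∀ U : {U : Submodule F V // Module.finrank F U = k},
      Nat.card {s // f s = U} =
        ∏ i : Fin k, (Fintype.card F ^ k - Fintype.card F ^ i.val) := by
    intro U
    rw [Nat.card_congr ((Equiv.subtypeEquivRight fun s => by
      simp only [f, Subtype.ext_iff]).trans (linearIndependentSpanEquiv U.1 U.2)),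
      card_linearIndependent (V := U.1) U.2.ge, U.2]
  simp [h]

theorem card_grassmannian {k : ℕ} (hk : k ≤ Module.finrank F V) :
    (Nat.card {U : Submodule F V // Module.finrank F U = k} : ℝ) =
      qBinom (Fintype.card F) (Module.finrank F V) k := by
  set q := Fintype.card F with hq
  have hq1 : 1 < q := Fintype.one_lt_card
  set n := Module.finrank F V
  have hq0 : (0 : ℝ) < q := by exact_mod_cast hq1.le
  have hq1' : (1 : ℝ) < q := by exact_mod_cast hq1
  have hfac : ∀ m, k ≤ m → ((∏ i : Fin k, (q ^ m - q ^ i.val) : ℕ) : ℝ) =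
      (∏ i ∈ Finset.range k, (q : ℝ) ^ i) * ∏ i ∈ Finset.range k, ((q : ℝ) ^ (m - i) - 1) := by
    intro m hm
    rw [← Finset.prod_mul_distrib, Nat.cast_prod,
      Finset.prod_range (fun i => (q : ℝ) ^ i * ((q : ℝ) ^ (m - i) - 1))]
    refine Finset.prod_congr rfl fun i _ => ?_
    have him : i.val ≤ m := i.2.le.trans hm
    rw [Nat.cast_sub (Nat.pow_le_pow_right hq1.le him), Nat.cast_pow, Nat.cast_pow, mul_sub,
      ← pow_add, Nat.add_sub_cancel' him, mul_one]
  have h := congrArg (fun a : ℕ => (a : ℝ)) (card_grassmannian_mul (F := F) (V := V) hk)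
  simp only [Nat.cast_mul] at h
  rw [hfac k le_rfl, hfac n hk] at h
  have hpos : ∏ i ∈ Finset.range k, (q : ℝ) ^ i ≠ 0 :=
    Finset.prod_ne_zero_iff.2 fun i _ => pow_ne_zero _ hq0.ne'
  have hpos' : ∏ i ∈ Finset.range k, ((q : ℝ) ^ (k - i) - 1) ≠ 0 := by
    refine Finset.prod_ne_zero_iff.2 fun i hi => (sub_pos.2 (one_lt_pow₀ hq1' ?_)).ne'
    have := Finset.mem_range.1 hi
    omega
  rw [qBinom, Finset.prod_div_distrib, eq_div_iff hpos']
  apply mul_left_cancel₀ hpos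
  linarith

theorem card_submodule :
    (Nat.card (Submodule F V) : ℝ) = Sq (Fintype.card F) (Module.finrank F V) := by
  rw [card_submodule_eq_sum, Nat.cast_sum, Sq]
  exact Finset.sum_congr rfl fun k hk =>
    card_grassmannian (Finset.mem_range_succ_iff.1 hk)

end SubspaceCount

section QBinomBounds

variable {q : ℕ}

theorem pow_le_qBinom (hq : 2 ≤ q) {n k : ℕ} (hk : k ≤ n) :
    (q : ℝ) ^ (k * (n - k)) ≤ qBinom q n k := by
  have hq1 : (1 : ℝ) < q := by exact_mod_cast hq
  rw [qBinom, mul_comm, pow_mul]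
  calc ((q : ℝ) ^ (n - k)) ^ k = ∏ j ∈ Finset.range k, (q : ℝ) ^ (n - k) := by simp
    _ ≤ _ := by
      refine Finset.prod_le_prod (fun _ _ => by positivity) fun j hj => ?_
      have hj := Finset.mem_range.1 hj
      have h1 : (1 : ℝ) < (q : ℝ) ^ (k - j) := one_lt_pow₀ hq1 (by omega)
      rw [le_div_iff₀ (by linarith), mul_sub, ← pow_add,
        show n - k + (k - j) = n - j by omega, mul_one]
      linarith [one_le_pow₀ (n := n - k) hq1.le]

theorem quarter_add_le_prod (k : ℕ) :
    (1 / 4 : ℝ) + (1 / 2) ^ (k + 2) ≤ ∏ j ∈ Finset.range (k + 1), (1 - (1 / 2 : ℝ) ^ (j + 1)) := by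
  induction k with
  | zero => norm_num
  | succ k ih =>
    rw [Finset.prod_range_succ]
    have h1 : (0 : ℝ) < (1 / 2) ^ k := by positivity
    have h2 : (1 / 2 : ℝ) ^ k ≤ 1 := pow_le_one₀ (by norm_num) (by norm_num)
    have h3 : (0 : ℝ) ≤ 1 - (1 / 2) ^ (k + 1 + 1) := by
      rw [pow_add, pow_add]; linarith
    refine le_trans ?_ (mul_le_mul_of_nonneg_right ih h3)
    simp only [pow_add]
    nlinarith

theorem qBinom_le (hq : 2 ≤ q) {n k : ℕ} (hk : k ≤ n) :
    qBinom q n k ≤ 4 * (q : ℝ) ^ (k * (n - k)) := by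
  have hq2 : (2 : ℝ) ≤ q := by exact_mod_cast hq
  have hq1 : (1 : ℝ) < q := by linarith
  have hprod : (1 / 4 : ℝ) ≤ ∏ j ∈ Finset.range k, (1 - (1 / 2 : ℝ) ^ (k - j)) := by
    rw [← Finset.prod_range_reflect]
    rcases k with _ | k
    · norm_num
    · have h := quarter_add_le_prod k
      have : (0 : ℝ) < (1 / 2) ^ (k + 2) := by positivity
      refine le_trans (by linarith) (h.trans_eq (Finset.prod_congr rfl fun j hj => ?_))
      have := Finset.mem_range.1 hj
      congr 2
      omega
  have hmain : qBinom q n k * ∏ j ∈ Finset.range k, (1 - (1 / 2 : ℝ) ^ (k - j)) ≤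
      (q : ℝ) ^ (k * (n - k)) := by
    rw [qBinom, ← Finset.prod_mul_distrib, mul_comm k, pow_mul]
    calc _ ≤ ∏ j ∈ Finset.range k, (q : ℝ) ^ (n - k) := by
          refine Finset.prod_le_prod (fun j hj => ?_) fun j hj => ?_
          · have hj := Finset.mem_range.1 hj
            have h1 : (1 : ℝ) ≤ (q : ℝ) ^ (k - j) := one_le_pow₀ hq1.le
            have h2 : (1 : ℝ) ≤ (q : ℝ) ^ (n - j) := one_le_pow₀ hq1.le
            have h3 : (1 / 2 : ℝ) ^ (k - j) ≤ 1 := pow_le_one₀ (by norm_num) (by norm_num)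
            exact mul_nonneg (div_nonneg (by linarith) (by linarith)) (by linarith)
          · have hj := Finset.mem_range.1 hj
            have h1 : (1 : ℝ) < (q : ℝ) ^ (k - j) := one_lt_pow₀ hq1 (by omega)
            have h0 : (0 : ℝ) < (q : ℝ) ^ (n - k) := by positivity
            have h2 : (1 : ℝ) ≤ (q : ℝ) ^ (k - j) * (1 / 2) ^ (k - j) := by
              rw [← mul_pow]
              exact one_le_pow₀ (by linarith)
            have h3 : (1 / 2 : ℝ) ^ (k - j) ≤ 1 := pow_le_one₀ (by norm_num) (by norm_num)
            rw [div_mul_eq_mul_div, div_le_iff₀ (by linarith),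
              show n - j = (n - k) + (k - j) by omega, pow_add]
            nlinarith
      _ = _ := by simp
  have h0 : (0 : ℝ) ≤ qBinom q n k := le_trans (by positivity) (pow_le_qBinom hq hk)
  nlinarith

theorem qBinom_pos (hq : 2 ≤ q) {n k : ℕ} (hk : k ≤ n) : 0 < qBinom q n k :=
  lt_of_lt_of_le (pow_pos (by exact_mod_cast (by omega : 0 < q)) _) (pow_le_qBinom hq hk)

theorem qBinom_le_Sq (hq : 2 ≤ q) {n k : ℕ} (hk : k ≤ n) : qBinom q n k ≤ Sq q n :=
  Finset.single_le_sum (f := fun k => qBinom q n k)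
    (fun _ hj => (qBinom_pos hq (Finset.mem_range_succ_iff.1 hj)).le)
    (Finset.mem_range_succ_iff.2 hk)

theorem Sq_le (hq : 2 ≤ q) (n : ℕ) :
    Sq q n ≤ 4 * (n + 1) * (q : ℝ) ^ ((n : ℝ) ^ 2 / 4) := by
  have hq1 : (1 : ℝ) < q := by exact_mod_cast hq
  calc Sq q n ≤ ∑ _k ∈ Finset.range (n + 1), 4 * (q : ℝ) ^ ((n : ℝ) ^ 2 / 4) := by
        refine Finset.sum_le_sum fun k hk => ?_
        have hk := Finset.mem_range_succ_iff.1 hk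
        refine (qBinom_le hq hk).trans ?_
        rw [← Real.rpow_natCast]
        gcongr
        · exact hq1.le
        · push_cast [Nat.cast_sub hk]
          nlinarith [sq_nonneg ((n : ℝ) - 2 * k)]
    _ = _ := by simp; ring

end QBinomBounds

/-! ### Counting invariant subspaces -/

section InvariantSubspaces

variable {F : Type} [Field F]
variable {V : Type} [AddCommGroup V] [Module F V] [Finite V]

/-- The submodules between `B` and `C` embed into the submodules of `C / B`. -/
theorem card_between_le (B C : Submodule F V) :
    Nat.card {U : Submodule F V // B ≤ U ∧ U ≤ C} ≤
      Nat.card (Submodule F (C ⧸ B.comap C.subtype)) := by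
  have : Finite (C ⧸ B.comap C.subtype) := Finite.of_surjective _ (Submodule.mkQ_surjective _)
  refine Nat.card_le_card_of_injective
    (fun U => (U.1.comap C.subtype).map (B.comap C.subtype).mkQ) fun U U' h => ?_
  have key : ∀ W : {U : Submodule F V // B ≤ U ∧ U ≤ C},
      (((W.1.comap C.subtype).map (B.comap C.subtype).mkQ).comap
        (B.comap C.subtype).mkQ).map C.subtype = W.1 := by
    intro W
    rw [Submodule.comap_map_mkQ, sup_eq_right.2 (Submodule.comap_mono W.2.1),
      Submodule.map_comap_subtype, inf_eq_right.2 W.2.2]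
  exact Subtype.ext ((key U).symm.trans ((congrArg
    (fun Z => (Z.comap (B.comap C.subtype).mkQ).map C.subtype) h).trans (key U')))

theorem finrank_comap_eq (N : V →ₗ[F] V) {B : Submodule F V} (hB : B ≤ LinearMap.range N) :
    Module.finrank F (B.comap N) = Module.finrank F B + Module.finrank F (LinearMap.ker N) := by
  have : FiniteDimensional F V := Module.Finite.of_finite
  have h := LinearMap.finrank_range_add_finrank_ker (N.domRestrict (B.comap N))
  rw [LinearMap.range_domRestrict, Submodule.map_comap_eq, inf_eq_right.2 hB] at h
  rw [← h, LinearMap.ker_domRestrict]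
  congr 1
  exact (Submodule.comapSubtypeEquivOfLe (LinearMap.ker_le_comap N)).finrank_eq

/-- If all eigenspaces of `T` have dimension at most `e`, every `T`-invariant subspace `U` is
generated, as an invariant subspace, by a subspace of dimension about half that of `U`. -/
theorem exists_generating_le (T : V →ₗ[F] V) (e : ℕ)
    (he : ∀ c : F, Module.finrank F (LinearMap.ker (T - c • LinearMap.id)) ≤ e)
    (U : Submodule F V) (hU : U ≤ U.comap T) :
    ∃ X : Submodule F V, X ≤ U ∧
      (∀ W : Submodule F V, W ≤ W.comap T → X ≤ W → U ≤ W) ∧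
      2 * Module.finrank F X ≤ Module.finrank F U + e := by
  have hfd : FiniteDimensional F V := Module.Finite.of_finite
  -- the invariant subspace generated by `X`
  let gen : Submodule F V → Submodule F V := fun X => sInf {W | W ≤ W.comap T ∧ X ≤ W}
  have le_gen : ∀ X, X ≤ gen X := fun X => le_sInf fun W hW => hW.2
  have gen_le : ∀ X W, W ≤ W.comap T → X ≤ W → gen X ≤ W := fun X W h1 h2 => sInf_le ⟨h1, h2⟩
  have gen_inv : ∀ X, ∀ x ∈ gen X, T x ∈ gen X := fun X x hx => by
    rw [Submodule.mem_sInf] at hx ⊢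
    exact fun W hW => hW.1 (hx W hW)
  let P : Set (Submodule F V) :=
    {X | X ≤ U ∧ 2 * Module.finrank F X ≤ Module.finrank F (gen X)}
  have hP : P.Finite := Set.toFinite _
  obtain ⟨X, hX, hmax⟩ := Set.Finite.exists_maximalFor
    (fun X : Submodule F V => Module.finrank F X) P hP ⟨⊥, bot_le, by simp⟩
  set W := gen X with hW
  have hWU : W ≤ U := gen_le X U hU hX.1
  -- by maximality `T` acts on `U / W` with every vector an eigenvector
  have hdep : ∀ x ∈ U, x ∉ W → T x ∈ W ⊔ Submodule.span F {x} := by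
    intro x hx hxW
    by_contra hTx
    have hxX : x ∉ X := fun h => hxW (le_gen X h)
    have hdim : Module.finrank F ↥(X ⊔ Submodule.span F {x}) = Module.finrank F X + 1 :=
      Submodule.finrank_sup_span_singleton hxX
    have hX'U : X ⊔ Submodule.span F {x} ≤ U :=
      sup_le hX.1 ((Submodule.span_singleton_le_iff_mem _ _).2 hx)
    have hWle : W ≤ gen (X ⊔ Submodule.span F {x}) :=
      gen_le _ _ (gen_inv _) (le_sup_left.trans (le_gen _))
    have hxg : x ∈ gen (X ⊔ Submodule.span F {x}) :=
      le_gen _ (Submodule.mem_sup_right (Submodule.mem_span_singleton_self x))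
    have hle : (W ⊔ Submodule.span F {x}) ⊔ Submodule.span F {T x} ≤
        gen (X ⊔ Submodule.span F {x}) :=
      sup_le (sup_le hWle ((Submodule.span_singleton_le_iff_mem _ _).2 hxg))
        ((Submodule.span_singleton_le_iff_mem _ _).2 (gen_inv _ _ hxg))
    have h2 := Submodule.finrank_mono hle
    rw [Submodule.finrank_sup_span_singleton hTx, Submodule.finrank_sup_span_singleton hxW] at h2
    have hX2 : 2 * Module.finrank F X ≤ Module.finrank F W := hX.2
    have := hmax (j := X ⊔ Submodule.span F {x}) ⟨hX'U, by omega⟩ (by simp only; omega)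
    simp only at this
    omega
  -- hence `T` acts on `U / W` by a scalar
  obtain ⟨c, hc⟩ : ∃ c : F, ∀ x ∈ U, T x - c • x ∈ W := by
    let TU : U →ₗ[F] U := T.restrict hU
    have hTU : W.comap U.subtype ≤ (W.comap U.subtype).comap TU := fun x hx =>
      gen_inv X _ hx
    let TQ := (W.comap U.subtype).mapQ (W.comap U.subtype) TU hTU
    obtain ⟨c, hc⟩ := LinearMap.exists_eq_smul_id_of_forall_notLinearIndependent
      (f := TQ) (fun v => by
        obtain ⟨x, rfl⟩ := (W.comap U.subtype).mkQ_surjective v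
        intro hli
        by_cases hxW : (x : V) ∈ W
        · exact hli.ne_zero 0 ((Submodule.Quotient.mk_eq_zero _).2 hxW)
        · obtain ⟨w, hw, z, hz, hwz⟩ := Submodule.mem_sup.1 (hdep x x.2 hxW)
          obtain ⟨c, rfl⟩ := Submodule.mem_span_singleton.1 hz
          have h0 : TQ ((W.comap U.subtype).mkQ x) = c • (W.comap U.subtype).mkQ x := by
            rw [← map_smul]
            refine (Submodule.Quotient.eq _).2 ?_
            change T x - c • (x : V) ∈ W
            rw [← hwz, add_sub_cancel_right]
            exact hw
          have := LinearIndependent.pair_iff.1 hli c (-1) (by rw [h0]; simp)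
          simpa using this.2)
    refine ⟨c, fun x hx => ?_⟩
    have h := LinearMap.congr_fun hc ((W.comap U.subtype).mkQ ⟨x, hx⟩)
    rw [LinearMap.smul_apply, Module.End.one_apply, ← map_smul] at h
    exact (Submodule.Quotient.eq (W.comap U.subtype)
      (x := TU ⟨x, hx⟩) (y := c • (⟨x, hx⟩ : U))).1 h
  -- so `U / W` is small
  have hdimUW : Module.finrank F U ≤ Module.finrank F W + e := by
    have h := LinearMap.finrank_range_add_finrank_ker ((T - c • LinearMap.id).domRestrict U)
    have h1 : Module.finrank F (LinearMap.range ((T - c • LinearMap.id).domRestrict U)) ≤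
        Module.finrank F W := by
      refine Submodule.finrank_mono ?_
      rintro _ ⟨x, rfl⟩
      exact hc x x.2
    have h2 : Module.finrank F (LinearMap.ker ((T - c • LinearMap.id).domRestrict U)) ≤ e := by
      refine le_trans ?_ (he c)
      rw [LinearMap.ker_domRestrict]
      exact LinearMap.finrank_le_finrank_of_injective
        (f := (U.subtype.restrict (p := (LinearMap.ker (T - c • LinearMap.id)).comap U.subtype)
          (q := LinearMap.ker (T - c • LinearMap.id)) fun x hx => hx))
        fun x y hxy => by
          have h := congrArg Subtype.val hxy
          exact Subtype.ext (Subtype.ext h)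
    omega
  obtain ⟨Y, hY⟩ := Submodule.exists_isCompl (W.comap U.subtype)
  have hYdim := Submodule.finrank_add_eq_of_isCompl hY
  have hWdim : Module.finrank F (W.comap U.subtype) = Module.finrank F W :=
    (Submodule.comapSubtypeEquivOfLe hWU).finrank_eq
  refine ⟨X ⊔ Y.map U.subtype, sup_le hX.1 (Submodule.map_subtype_le U Y), ?_, ?_⟩
  · intro W' hW' hle x hx
    have h1 : W ≤ W' := gen_le X W' hW' (le_sup_left.trans hle)
    have h2 : (⟨x, hx⟩ : U) ∈ W.comap U.subtype ⊔ Y := by rw [hY.sup_eq_top]; trivial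
    obtain ⟨w, hw, y, hy, hwy⟩ := Submodule.mem_sup.1 h2
    have h3 : (w : V) + y = x := congrArg Subtype.val hwy
    rw [← h3]
    exact W'.add_mem (h1 hw) (hle (Submodule.mem_sup_right ⟨y, hy, rfl⟩))
  · have h1 := Submodule.finrank_add_le_finrank_add_finrank X (Y.map U.subtype)
    rw [Submodule.finrank_map_subtype_eq] at h1
    have hX2 : 2 * Module.finrank F X ≤ Module.finrank F W := hX.2
    omega

variable [Fintype F]

theorem card_between_comap_le (N : V →ₗ[F] V) {B : Submodule F V}
    (hB : B ≤ LinearMap.range N) :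
    (Nat.card {U : Submodule F V // B ≤ U ∧ U ≤ B.comap N} : ℝ) ≤
      Sq (Fintype.card F) (Module.finrank F (LinearMap.ker N)) := by
  by_cases hBC : B ≤ B.comap N
  · have : Finite (B.comap N ⧸ B.comap (B.comap N).subtype) :=
      Finite.of_surjective _ (Submodule.mkQ_surjective _)
    refine (Nat.cast_le.2 (card_between_le B (B.comap N))).trans_eq ?_
    rw [card_submodule]
    congr 1
    have : FiniteDimensional F V := Module.Finite.of_finite
    have h := Submodule.finrank_quotient_add_finrank (B.comap (B.comap N).subtype)
    have h' : Module.finrank F (B.comap (B.comap N).subtype) = Module.finrank F B :=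
      (Submodule.comapSubtypeEquivOfLe hBC).finrank_eq
    have := finrank_comap_eq N hB
    omega
  · have : IsEmpty {U : Submodule F V // B ≤ U ∧ U ≤ B.comap N} :=
      ⟨fun U => hBC (U.2.1.trans U.2.2)⟩
    rw [Nat.card_of_isEmpty, Nat.cast_zero, ← card_submodule (V := LinearMap.ker N)]
    positivity

/-- The number of `N`-invariant subspaces is bounded by the number of pairs consisting of a
subspace of the range and a subspace of the kernel. -/
theorem card_invariant_le (N : V →ₗ[F] V) :
    (Nat.card {U : Submodule F V // U ≤ U.comap N} : ℝ) ≤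
      Sq (Fintype.card F) (Module.finrank F (LinearMap.range N)) *
        Sq (Fintype.card F) (Module.finrank F (LinearMap.ker N)) := by
  classical
  let f : {U : Submodule F V // U ≤ U.comap N} →
      Σ B : Set.Iic (LinearMap.range N), {U : Submodule F V // B.1 ≤ U ∧ U ≤ B.1.comap N} :=
    fun U => ⟨⟨U.1.map N, LinearMap.map_le_range⟩,
      ⟨U.1, Submodule.map_le_iff_le_comap.2 U.2, Submodule.le_comap_map N U.1⟩⟩
  have hf : Function.Injective f := fun U U' h => by
    have := congrArg (fun x => x.2.1) h
    exact Subtype.ext this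
  have : Fintype (Set.Iic (LinearMap.range N)) := Fintype.ofFinite _
  refine (Nat.cast_le.2 (Nat.card_le_card_of_injective f hf)).trans ?_
  rw [Nat.card_sigma, Nat.cast_sum]
  refine (Finset.sum_le_sum fun B _ => card_between_comap_le N B.2).trans_eq ?_
  rw [Finset.sum_const, nsmul_eq_mul, Finset.card_univ, ← Nat.card_eq_fintype_card,
    ← Nat.card_congr (Submodule.mapIic (LinearMap.range N)).toEquiv, card_submodule]

theorem card_submodule_finrank_le (P : ℕ → Prop) {α : ℝ}
    (hP : ∀ k ≤ Module.finrank F V, P k →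
      (k : ℝ) * ((Module.finrank F V : ℝ) - k) ≤ α) :
    (Nat.card {U : Submodule F V // P (Module.finrank F U)} : ℝ) ≤
      4 * (Module.finrank F V + 1) * (Fintype.card F : ℝ) ^ α := by
  classical
  have : Fintype (Submodule F V) := Fintype.ofFinite _
  have hq : 2 ≤ Fintype.card F := Fintype.one_lt_card
  have hq1 : (1 : ℝ) < Fintype.card F := by exact_mod_cast hq
  have hfib : ∀ k ∈ Finset.range (Module.finrank F V + 1),
      (((Finset.univ.filter fun U : Submodule F V => P (Module.finrank F U)).filter
        fun U : Submodule F V => Module.finrank F U = k).card : ℝ) ≤ 4 * (Fintype.card F : ℝ) ^ α := by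
    intro k hk
    have hk := Finset.mem_range_succ_iff.1 hk
    by_cases hPk : P k
    · have h1 : ((Finset.univ.filter fun U : Submodule F V => P (Module.finrank F U)).filter
          fun U : Submodule F V => Module.finrank F U = k).card ≤
          Nat.card {U : Submodule F V // Module.finrank F U = k} := by
        rw [Nat.card_eq_fintype_card, Fintype.card_subtype, Finset.filter_filter]
        exact Finset.card_le_card (Finset.monotone_filter_right _ (fun U _ h => h.2))
      refine (Nat.cast_le.2 h1).trans ?_
      rw [card_grassmannian hk]
      refine (qBinom_le hq hk).trans ?_
      rw [← Real.rpow_natCast]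
      gcongr
      · exact hq1.le
      · push_cast [Nat.cast_sub hk]
        exact hP k hk hPk
    · rw [Finset.filter_filter, Finset.filter_false_of_mem, Finset.card_empty, Nat.cast_zero]
      · positivity
      · rintro U - ⟨h1, h2⟩
        exact hPk (h2 ▸ h1)
  rw [Nat.card_eq_fintype_card, Fintype.card_subtype,
    Finset.card_eq_sum_card_fiberwise (t := Finset.range (Module.finrank F V + 1))
      (f := fun U : Submodule F V => Module.finrank F U)
      fun U _ => Finset.mem_coe.2 (Finset.mem_range_succ_iff.2 (Submodule.finrank_le U)),
    Nat.cast_sum]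
  refine (Finset.sum_le_sum hfib).trans_eq ?_
  simp only [Finset.sum_const, Finset.card_range, nsmul_eq_mul]
  push_cast
  ring

theorem card_invariant_le_of_small_eigenspaces (T : V →ₗ[F] V)
    (hT : ∀ c : F, 20 * Module.finrank F (LinearMap.ker (T - c • LinearMap.id)) ≤
      Module.finrank F V) :
    (Nat.card {U : Submodule F V // U ≤ U.comap T} : ℝ) ≤
      8 * (Module.finrank F V + 1) *
        (Fintype.card F : ℝ) ^ (49 / 200 * (Module.finrank F V : ℝ) ^ 2) := by
  classical
  set n := Module.finrank F V with hn
  have hgen := exists_generating_le T (n / 20) fun c => by have := hT c; omega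
  choose! X hXU hXgen hXdim using hgen
  let f : {U : Submodule F V // U ≤ U.comap T} →
      {U : Submodule F V // 4 * n < 5 * Module.finrank F U} ⊕
        {U : Submodule F V // 40 * Module.finrank F U ≤ 17 * n} := fun U =>
    if h : 4 * n < 5 * Module.finrank F U.1 then Sum.inl ⟨U.1, h⟩
    else Sum.inr ⟨X U.1, by have := hXdim U.1 U.2; omega⟩
  have hf : Function.Injective f := by
    intro U U' h
    by_cases h1 : 4 * n < 5 * Module.finrank F U.1 <;>
      by_cases h2 : 4 * n < 5 * Module.finrank F U'.1
    · simpa [f, h1, h2, Subtype.ext_iff] using h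
    · simp [f, h1, h2] at h
    · simp [f, h1, h2] at h
    · have h : X U.1 = X U'.1 := by simpa [f, h1, h2] using h
      exact Subtype.ext (le_antisymm (hXgen U.1 U.2 U'.1 U'.2 (h ▸ hXU U'.1 U'.2))
        (hXgen U'.1 U'.2 U.1 U.2 (h ▸ hXU U.1 U.2)))
  refine (Nat.cast_le.2 (Nat.card_le_card_of_injective f hf)).trans ?_
  rw [Nat.card_sum, Nat.cast_add]
  have h1 := card_submodule_finrank_le (F := F) (V := V) (fun k => 4 * n < 5 * k)
    (α := 49 / 200 * (n : ℝ) ^ 2) fun k hk h => by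
      have h : (4 * n : ℝ) ≤ 5 * k := by exact_mod_cast h.le
      have hk : (k : ℝ) ≤ n := by exact_mod_cast hk
      have h0 : (0 : ℝ) ≤ n := n.cast_nonneg
      rw [← hn]
      nlinarith
  have h2 := card_submodule_finrank_le (F := F) (V := V) (fun k => 40 * k ≤ 17 * n)
    (α := 49 / 200 * (n : ℝ) ^ 2) fun k hk h => by
      have h : (40 * k : ℝ) ≤ 17 * n := by exact_mod_cast h
      have h0 : (0 : ℝ) ≤ n := n.cast_nonneg
      have h0 : (0 : ℝ) ≤ k := k.cast_nonneg
      rw [← hn]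
      nlinarith
  rw [← hn] at h1 h2
  linarith

theorem card_invariant_le_of_large_eigenspace (T : V →ₗ[F] V) (c : F)
    (hc : Module.finrank F V ≤
      20 * Module.finrank F (LinearMap.ker (T - c • LinearMap.id))) :
    (Nat.card {U : Submodule F V // U ≤ U.comap T} : ℝ) ≤
      16 * (Module.finrank F V + 1) ^ 2 *
        (Fintype.card F : ℝ) ^ ((Module.finrank F V : ℝ) ^ 2 / 4 -
          Module.finrank F (LinearMap.range (T - c • LinearMap.id)) *
            Module.finrank F V / 40) := by
  have : FiniteDimensional F V := Module.Finite.of_finite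
  have hq : 2 ≤ Fintype.card F := Fintype.one_lt_card
  have hq1 : (1 : ℝ) < Fintype.card F := by exact_mod_cast hq
  have hle : Nat.card {U : Submodule F V // U ≤ U.comap T} ≤
      Nat.card {U : Submodule F V // U ≤ U.comap (T - c • LinearMap.id)} :=
    Nat.card_le_card_of_injective
      (fun U => ⟨U.1, fun x hx => U.1.sub_mem (U.2 hx) (U.1.smul_mem c hx)⟩)
      fun U U' h => by simpa [Subtype.ext_iff] using h
  refine (Nat.cast_le.2 hle).trans ((card_invariant_le _).trans ?_)
  have hrk := LinearMap.finrank_range_add_finrank_ker (T - c • LinearMap.id)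
  set r := Module.finrank F (LinearMap.range (T - c • LinearMap.id))
  set m := Module.finrank F (LinearMap.ker (T - c • LinearMap.id))
  set n := Module.finrank F V
  have hrk' : (r : ℝ) + m = n := by exact_mod_cast hrk
  have hc' : (n : ℝ) ≤ 20 * m := by exact_mod_cast hc
  have hr0 : (0 : ℝ) ≤ r := r.cast_nonneg
  have hm0 : (0 : ℝ) ≤ m := m.cast_nonneg
  have h0 : ∀ j, (0 : ℝ) ≤ Sq (Fintype.card F) j := fun j =>
    (qBinom_pos hq j.zero_le).le.trans (qBinom_le_Sq hq j.zero_le)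
  calc _ ≤ (4 * (r + 1) * (Fintype.card F : ℝ) ^ ((r : ℝ) ^ 2 / 4)) *
        (4 * (m + 1) * (Fintype.card F : ℝ) ^ ((m : ℝ) ^ 2 / 4)) :=
        mul_le_mul (Sq_le hq r) (Sq_le hq m) (h0 m) (by positivity)
    _ = (16 * ((r + 1) * (m + 1))) *
        (Fintype.card F : ℝ) ^ ((r : ℝ) ^ 2 / 4 + (m : ℝ) ^ 2 / 4) := by
        rw [Real.rpow_add (by linarith)]
        ring
    _ ≤ _ := by
        gcongr
        · nlinarith
        · exact hq1.le
        · nlinarith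

end InvariantSubspaces

/-! ### Monomial matrices -/

section Monomial

variable {F : Type} [Field F] {n : ℕ}

/-- `c` records the columns of the monomial matrix `M`: the `i`-th column of `M` is the
`(c i).1`-th standard basis vector scaled by `(c i).2`. -/
def IsColumnCode (M : Matrix (Fin n) (Fin n) F) (c : Fin n → Fin n × F) : Prop :=
  Function.Injective (fun i => (c i).1) ∧ (∀ i, (c i).2 ≠ 0) ∧
    ∀ i, M *ᵥ Pi.single i 1 = (c i).2 • Pi.single (c i).1 1

theorem IsColumnCode.eq_of_eq {M M' : Matrix (Fin n) (Fin n) F} {c : Fin n → Fin n × F}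
    (h : IsColumnCode M c) (h' : IsColumnCode M' c) : M = M' := by
  apply Matrix.toLin'.injective
  refine LinearMap.pi_ext' fun i => LinearMap.ext_ring ?_
  simpa using (h.2.2 i).trans (h'.2.2 i).symm

theorem exists_isColumnCode (M : GL (Fin n) F) (hM : M ∈ MonomialGroup F n) :
    ∃ c, IsColumnCode (M : Matrix (Fin n) (Fin n) F) c := by
  have hinj : ∀ (M : GL (Fin n) F) (x : Fin n → F),
      (M : Matrix (Fin n) (Fin n) F) *ᵥ x = 0 → x = 0 := fun M x hx => by
    have : (↑M⁻¹ : Matrix (Fin n) (Fin n) F) *ᵥ ((M : Matrix (Fin n) (Fin n) F) *ᵥ x) = 0 := by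
      rw [hx, Matrix.mulVec_zero]
    rwa [Matrix.mulVec_mulVec, ← Units.val_mul, inv_mul_cancel, Units.val_one,
      Matrix.one_mulVec] at this
  induction hM using Subgroup.closure_induction with
  | mem M hM =>
    rcases hM with ⟨σ, hσ⟩ | ⟨d, hd⟩
    · refine ⟨fun i => (σ.symm i, 1), σ.symm.injective, fun i => one_ne_zero, fun i => ?_⟩
      rw [hσ]
      ext j
      simp [Equiv.Perm.permMatrix, Matrix.mulVec_single, PEquiv.toMatrix_apply, Pi.single_apply,
        Equiv.eq_symm_apply, eq_comm]
    · have h : ∀ i, (M : Matrix (Fin n) (Fin n) F) *ᵥ Pi.single i 1 = d i • Pi.single i 1 := by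
        intro i
        rw [hd]
        ext j
        by_cases hij : j = i <;> simp [Matrix.mulVec_diagonal, hij]
      refine ⟨fun i => (i, d i), fun i j h => h, fun i hi => ?_, h⟩
      have h0 := hinj M (Pi.single i 1) (by rw [h i, show d i = 0 from hi, zero_smul])
      simpa using congrFun h0 i
  | one =>
    exact ⟨fun i => (i, 1), fun i j h => h, fun i => one_ne_zero,
      fun i => by rw [Units.val_one, Matrix.one_mulVec, one_smul]⟩
  | mul M M' _ _ ih ih' =>
    obtain ⟨c, hc1, hc2, hc3⟩ := ih
    obtain ⟨c', hc1', hc2', hc3'⟩ := ih'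
    refine ⟨fun i => ((c (c' i).1).1, (c' i).2 * (c (c' i).1).2), hc1.comp hc1',
      fun i => mul_ne_zero (hc2' i) (hc2 _), fun i => ?_⟩
    rw [Units.val_mul, ← Matrix.mulVec_mulVec, hc3' i, Matrix.mulVec_smul, hc3, smul_smul]
  | inv M _ ih =>
    obtain ⟨c, hc1, hc2, hc3⟩ := ih
    let σ : Equiv.Perm (Fin n) := Equiv.ofBijective _ (Finite.injective_iff_bijective.1 hc1)
    refine ⟨fun i => (σ.symm i, (c (σ.symm i)).2⁻¹), σ.symm.injective,
      fun i => inv_ne_zero (hc2 _), fun i => ?_⟩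
    have h := hc3 (σ.symm i)
    have hσ : (c (σ.symm i)).1 = i := σ.apply_symm_apply i
    rw [hσ] at h
    have h2 := congrArg (fun x => (↑M⁻¹ : Matrix (Fin n) (Fin n) F) *ᵥ x) h
    rw [Matrix.mulVec_mulVec, ← Units.val_mul, inv_mul_cancel, Units.val_one,
      Matrix.one_mulVec, Matrix.mulVec_smul] at h2
    rw [h2, smul_smul, inv_mul_cancel₀ (hc2 _), one_smul]

variable [DecidableEq F]

/-- The columns on which a matrix with column code `c` differs from the scalar matrix `a`. -/
def nonscalarColumns (c : Fin n → Fin n × F) (a : F) : Finset (Fin n) :=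
  Finset.univ.filter fun i => c i ≠ (i, a)

theorem IsColumnCode.eq_scalar {M : Matrix (Fin n) (Fin n) F} {c : Fin n → Fin n × F}
    (h : IsColumnCode M c) {a : F} (ha : nonscalarColumns c a = ∅) :
    Matrix.toLin' M = a • LinearMap.id := by
  refine LinearMap.pi_ext' fun i => LinearMap.ext_ring ?_
  have hi : c i = (i, a) := by
    by_contra hi
    exact Finset.notMem_empty i (ha ▸ Finset.mem_filter.2 ⟨Finset.mem_univ i, hi⟩)
  have := h.2.2 i
  rw [hi] at this
  simpa using this

theorem IsColumnCode.card_nonscalarColumns_le {M : Matrix (Fin n) (Fin n) F}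
    {c : Fin n → Fin n × F} (h : IsColumnCode M c) (a : F) :
    (nonscalarColumns c a).card ≤
      3 * Module.finrank F (LinearMap.range (Matrix.toLin' M - a • LinearMap.id)) := by
  obtain ⟨hσ, hd, hM⟩ := h
  set σ : Fin n → Fin n := fun i => (c i).1 with hσdef
  let d : Fin n → F := fun i => (c i).2
  set N := Matrix.toLin' M - a • LinearMap.id with hN
  set J := nonscalarColumns c a
  let P : Set (Finset (Fin n)) :=
    {I | I ⊆ J ∧ ∀ i ∈ I, ∀ j ∈ I, i ≠ j → σ i ≠ j}
  obtain ⟨I, ⟨hIJ, hI⟩, hmax⟩ := Set.Finite.exists_maximalFor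
    (fun I : Finset (Fin n) => I.card) P (Set.toFinite P)
    ⟨∅, by simp [P]⟩
  -- by maximality every element of `J` is in `I` or adjacent to `I`
  have hcover : J ⊆ I ∪ (I.image σ ∪ Finset.univ.filter fun i => σ i ∈ I) := by
    intro i hi
    by_contra hcon
    simp only [Finset.mem_union, Finset.mem_image, Finset.mem_filter, Finset.mem_univ, true_and,
      not_or, not_exists, not_and] at hcon
    obtain ⟨h1, h2, h3⟩ := hcon
    have hP : insert i I ∈ P := by
      refine ⟨Finset.insert_subset hi hIJ, fun x hx y hy hxy hxy' => ?_⟩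
      rcases Finset.mem_insert.1 hx with rfl | hx' <;>
        rcases Finset.mem_insert.1 hy with rfl | hy'
      · exact hxy rfl
      · exact h3 (hxy' ▸ hy')
      · exact h2 x hx' hxy'
      · exact hI x hx' y hy' hxy hxy'
    have := hmax hP (by simp only [Finset.card_insert_of_notMem h1]; omega)
    simp only [Finset.card_insert_of_notMem h1] at this
    omega
  have hcard : J.card ≤ 3 * I.card := by
    have h1 := Finset.card_le_card hcover
    have h2 := Finset.card_union_le I (I.image σ ∪ Finset.univ.filter fun i => σ i ∈ I)
    have h3 := Finset.card_union_le (I.image σ) (Finset.univ.filter fun i => σ i ∈ I)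
    have h4 : (I.image σ).card ≤ I.card := Finset.card_image_le
    have h5 : (Finset.univ.filter fun i => σ i ∈ I).card ≤ I.card :=
      Finset.card_le_card_of_injOn σ (fun i hi => (Finset.mem_filter.1 hi).2) hσ.injOn
    omega
  refine hcard.trans (Nat.mul_le_mul_left 3 ?_)
  -- the columns indexed by `I` are linearly independent
  have hNi : ∀ i j, N (Pi.single i 1) j =
      (if j = σ i then d i else 0) - (if j = i then a else 0) := by
    intro i j
    rw [hN, LinearMap.sub_apply, Matrix.toLin'_apply, hM i]
    simp [Pi.single_apply, d, hσdef]
  have hli : LinearIndependent F (fun i : I => N (Pi.single (i : Fin n) 1)) := by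
    rw [Fintype.linearIndependent_iff]
    intro g hg i
    have h := congrFun hg (σ i)
    rw [Finset.sum_apply, Finset.sum_eq_single i] at h
    · rw [Pi.smul_apply, hNi, smul_eq_mul, Pi.zero_apply] at h
      refine (mul_eq_zero.1 h).resolve_right ?_
      by_cases hi : σ i = i
      · rw [if_pos rfl, if_pos hi]
        refine sub_ne_zero.2 fun hda => ?_
        exact (Finset.mem_filter.1 (hIJ i.2)).2 (Prod.ext hi hda)
      · rw [if_pos rfl, if_neg hi, sub_zero]
        exact hd i
    · intro j _ hji
      have hji' : (i : Fin n) ≠ j := fun h => hji (Subtype.ext h.symm)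
      rw [Pi.smul_apply, hNi, if_neg fun h => hji' (hσ h), if_neg (hI i i.2 j j.2 hji'),
        sub_zero, smul_zero]
    · exact fun h => absurd (Finset.mem_univ i) h
  calc I.card = Module.finrank F
        (Submodule.span F (Set.range fun i : I => N (Pi.single (i : Fin n) 1))) := by
        rw [finrank_span_eq_card hli, Fintype.card_coe]
    _ ≤ _ := Submodule.finrank_mono (Submodule.span_le.2 (by
        rintro _ ⟨i, rfl⟩
        exact ⟨_, rfl⟩))

end Monomial

section MonomialFixedSubspaces

theorem sum_pow_card_nonscalarColumns_le {F : Type} [Fintype F] [DecidableEq F] {n : ℕ} (a : F)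
    {y : ℝ} (hy : 0 ≤ y) :
    ∑ c : Fin n → Fin n × F with nonscalarColumns c a ≠ ∅, y ^ (nonscalarColumns c a).card ≤
      (1 + n * Fintype.card F * y) ^ n - 1 := by
  have hprod : ∀ c : Fin n → Fin n × F, y ^ (nonscalarColumns c a).card =
      ∏ i, if c i = (i, a) then 1 else y := by
    intro c
    rw [Finset.prod_ite]
    simp [nonscalarColumns]
  have htot : ∑ c : Fin n → Fin n × F, y ^ (nonscalarColumns c a).card ≤
      (1 + n * Fintype.card F * y) ^ n := by
    simp only [hprod]
    have h := Finset.prod_univ_sum (fun _ : Fin n => (Finset.univ : Finset (Fin n × F)))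
      (fun i p => if p = (i, a) then (1 : ℝ) else y)
    rw [Fintype.piFinset_univ] at h
    rw [← h]
    calc _ ≤ ∏ _i : Fin n, (1 + n * Fintype.card F * y) := by
          refine Finset.prod_le_prod
            (fun i _ => Finset.sum_nonneg fun p _ => by split_ifs <;> positivity) fun i _ => ?_
          calc _ ≤ ∑ p : Fin n × F, ((if p = (i, a) then (1 : ℝ) else 0) + y) :=
                Finset.sum_le_sum fun p _ => by split_ifs <;> simp [hy]
            _ = _ := by simp [Finset.sum_add_distrib]
      _ = _ := by simp
  have hone : (1 : ℝ) ≤ ∑ c : Fin n → Fin n × F with ¬ nonscalarColumns c a ≠ ∅,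
      y ^ (nonscalarColumns c a).card := by
    have hmem : (fun i => (i, a)) ∈ Finset.univ.filter
        fun c : Fin n → Fin n × F => ¬ nonscalarColumns c a ≠ ∅ := by
      simp [nonscalarColumns]
    refine le_trans ?_ (Finset.single_le_sum
      (f := fun c : Fin n → Fin n × F => y ^ (nonscalarColumns c a).card)
      (fun c _ => by positivity) hmem)
    simp [nonscalarColumns]
  have := Finset.sum_filter_add_sum_filter_not Finset.univ
    (fun c : Fin n → Fin n × F => nonscalarColumns c a ≠ ∅)
    (fun c => y ^ (nonscalarColumns c a).card)
  linarith

variable {F : Type} [Field F] [Fintype F] [DecidableEq F] {n : ℕ}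

theorem IsColumnCode.card_invariant_le {M : Matrix (Fin n) (Fin n) F} {c : Fin n → Fin n × F}
    (h : IsColumnCode M c) :
    (Nat.card {U : Submodule F (Fin n → F) // U ≤ U.comap (Matrix.toLin' M)} : ℝ) ≤
      8 * (n + 1) * (Fintype.card F : ℝ) ^ (49 / 200 * (n : ℝ) ^ 2) +
        ∑ a : F, 16 * (n + 1) ^ 2 * (Fintype.card F : ℝ) ^ ((n : ℝ) ^ 2 / 4) *
          ((Fintype.card F : ℝ) ^ (-(n : ℝ) / 120)) ^ (nonscalarColumns c a).card := by
  have hn : Module.finrank F (Fin n → F) = n := Module.finrank_fin_fun F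
  have hq : 2 ≤ Fintype.card F := Fintype.one_lt_card
  have hq1 : (1 : ℝ) < Fintype.card F := by exact_mod_cast hq
  by_cases hT : ∀ c : F,
      20 * Module.finrank F (LinearMap.ker (Matrix.toLin' M - c • LinearMap.id)) ≤ n
  · have h1 := card_invariant_le_of_small_eigenspaces (Matrix.toLin' M) (by rwa [hn])
    rw [hn] at h1
    exact h1.trans (le_add_of_nonneg_right (Finset.sum_nonneg fun a _ => by positivity))
  · push Not at hT
    obtain ⟨a, ha⟩ := hT
    have h1 := card_invariant_le_of_large_eigenspace (Matrix.toLin' M) a (by rw [hn]; exact ha.le)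
    have h2 := h.card_nonscalarColumns_le a
    rw [hn] at h1
    refine h1.trans (le_add_of_nonneg_of_le (by positivity) ?_)
    refine le_trans ?_ (Finset.single_le_sum (f := fun a => 16 * ((n : ℝ) + 1) ^ 2 *
      (Fintype.card F : ℝ) ^ ((n : ℝ) ^ 2 / 4) *
        ((Fintype.card F : ℝ) ^ (-(n : ℝ) / 120)) ^ (nonscalarColumns c a).card)
      (fun a _ => by positivity) (Finset.mem_univ a))
    rw [mul_assoc (16 * ((n : ℝ) + 1) ^ 2),
      ← Real.rpow_natCast ((Fintype.card F : ℝ) ^ (-(n : ℝ) / 120)),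
      ← Real.rpow_mul (by linarith), ← Real.rpow_add (by linarith)]
    gcongr
    · exact hq1.le
    · have h3 : ((nonscalarColumns c a).card : ℝ) ≤ 3 *
          Module.finrank F (LinearMap.range (Matrix.toLin' M - a • LinearMap.id)) := by
        exact_mod_cast h2
      have h0 : (0 : ℝ) ≤ n := n.cast_nonneg
      nlinarith

/-- A bound for the total number of subspaces fixed by the nonscalar monomial matrices
of size `n` over a field with `q` elements. -/
noncomputable def nonscalarBound (q n : ℕ) : ℝ :=
  (n * q) ^ n * (8 * (n + 1) * (q : ℝ) ^ (49 / 200 * (n : ℝ) ^ 2)) +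
    q * (16 * (n + 1) ^ 2 * (q : ℝ) ^ ((n : ℝ) ^ 2 / 4) *
      ((1 + n * q * (q : ℝ) ^ (-(n : ℝ) / 120)) ^ n - 1))

theorem sum_card_invariant_le {ι : Type} (s : Finset ι) (M : ι → Matrix (Fin n) (Fin n) F)
    (hM : Function.Injective M) (c : ι → Fin n → Fin n × F) (hc : ∀ i, IsColumnCode (M i) (c i))
    (hs : ∀ i ∈ s, ∀ a, nonscalarColumns (c i) a ≠ ∅) :
    ∑ i ∈ s, (Nat.card {U : Submodule F (Fin n → F) //
        U ≤ U.comap (Matrix.toLin' (M i))} : ℝ) ≤ nonscalarBound (Fintype.card F) n := by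
  have hcinj : Function.Injective c := fun i j hij => hM ((hc i).eq_of_eq (hij ▸ hc j))
  refine (Finset.sum_le_sum fun i _ => (hc i).card_invariant_le).trans ?_
  rw [Finset.sum_add_distrib, nonscalarBound]
  gcongr
  · rw [Finset.sum_const, nsmul_eq_mul]
    gcongr
    have h1 : s.card ≤ (Finset.univ : Finset (Fin n → Fin n × F)).card :=
      Finset.card_le_card_of_injOn c (fun _ _ => Finset.mem_coe.2 (Finset.mem_univ _)) hcinj.injOn
    have h2 : (Finset.univ : Finset (Fin n → Fin n × F)).card = (n * Fintype.card F) ^ n := by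
      simp
    rw [h2] at h1
    exact_mod_cast h1
  · rw [Finset.sum_comm]
    refine (Finset.sum_le_card_nsmul _ _ _ fun a _ => ?_).trans_eq
      (by rw [nsmul_eq_mul, Finset.card_univ])
    rw [← Finset.mul_sum]
    gcongr
    refine le_trans ?_ (sum_pow_card_nonscalarColumns_le a (by positivity))
    rw [← Finset.sum_image (s := s) (g := c)
      (f := fun c => ((Fintype.card F : ℝ) ^ (-(n : ℝ) / 120)) ^ (nonscalarColumns c a).card)
      hcinj.injOn]
    refine Finset.sum_le_sum_of_subset_of_nonneg ?_ fun _ _ _ => by positivity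
    intro x hx
    obtain ⟨i, hi, rfl⟩ := Finset.mem_image.1 hx
    exact Finset.mem_filter.2 ⟨Finset.mem_univ _, hs i hi a⟩

end MonomialFixedSubspaces

/-! ### Counting orbits -/

section Orbits

theorem card_quot_mul_card_group (G X : Type) [Group G] [Fintype G] [Finite X] [MulAction G X] :
    Nat.card (Quot fun x y : X => ∃ g : G, g • x = y) * Nat.card G =
      ∑ g : G, Nat.card (MulAction.fixedBy X g) := by
  classical
  have : Fintype X := Fintype.ofFinite X
  have hrel : (fun x y : X => ∃ g : G, g • x = y) = (MulAction.orbitRel G X).r := by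
    ext x y
    constructor
    · rintro ⟨g, rfl⟩
      exact (MulAction.orbitRel G X).symm ⟨g, rfl⟩
    · intro h
      exact (MulAction.orbitRel G X).symm h
  rw [hrel]
  simp only [Nat.card_eq_fintype_card]
  rw [MulAction.sum_card_fixedBy_eq_card_orbits_mul_card_group G X, ← Nat.card_eq_fintype_card,
    ← Nat.card_eq_fintype_card]
  rfl

theorem card_quot_bounds (G X : Type) [Group G] [Fintype G] [Finite X] [MulAction G X]
    (s : Finset G) (hs : ∀ g ∉ s, ∀ x : X, g • x = x) (t : G → ℕ)
    (ht : ∀ g, Nat.card (MulAction.fixedBy X g) ≤ t g) :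
    (Fintype.card G - s.card) * Nat.card X ≤
        Nat.card (Quot fun x y : X => ∃ g : G, g • x = y) * Nat.card G ∧
      Nat.card (Quot fun x y : X => ∃ g : G, g • x = y) * Nat.card G ≤
        (Fintype.card G - s.card) * Nat.card X + ∑ g ∈ s, t g := by
  classical
  rw [card_quot_mul_card_group, ← Finset.sum_compl_add_sum s]
  have h : ∑ g ∈ sᶜ, Nat.card (MulAction.fixedBy X g) =
      (Fintype.card G - s.card) * Nat.card X := by
    rw [← Finset.card_compl, ← smul_eq_mul, ← Finset.sum_const]
    refine Finset.sum_congr rfl fun g hg => ?_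
    rw [show MulAction.fixedBy X g = Set.univ from
      Set.eq_univ_of_forall fun x => hs g (Finset.mem_compl.1 hg) x]
    exact Nat.card_congr (Equiv.Set.univ X)
  rw [h]
  exact ⟨Nat.le_add_right _ _, Nat.add_le_add_left (Finset.sum_le_sum fun g _ => ht g) _⟩

variable {F : Type} [Field F] {n : ℕ}

/-- The action of a matrix group on subspaces by taking images. -/
@[reducible] def subspaceAction (G : Subgroup (GL (Fin n) F)) :
    MulAction G (Submodule F (Fin n → F)) where
  smul g U := U.map (Matrix.toLin' (g.1 : Matrix (Fin n) (Fin n) F))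
  one_smul U := by
    change U.map (Matrix.toLin' _) = U
    simp
  mul_smul g h U := by
    change U.map (Matrix.toLin' _) = (U.map (Matrix.toLin' _)).map (Matrix.toLin' _)
    rw [← Submodule.map_comp, ← Matrix.toLin'_mul]
    rfl

theorem finrank_map_toLin' (M : GL (Fin n) F) (U : Submodule F (Fin n → F)) :
    Module.finrank F (U.map (Matrix.toLin' (M : Matrix (Fin n) (Fin n) F))) =
      Module.finrank F U := by
  refine (Submodule.equivMapOfInjective _ ?_ U).finrank_eq.symm
  intro x y hxy
  have h := congrArg (fun z => (↑M⁻¹ : Matrix (Fin n) (Fin n) F) *ᵥ z) hxy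
  simp only [Matrix.toLin'_apply, Matrix.mulVec_mulVec] at h
  rwa [← Units.val_mul, inv_mul_cancel, Units.val_one, Matrix.one_mulVec, Matrix.one_mulVec] at h

/-- The action of a matrix group on subspaces of a given dimension by taking images. -/
@[reducible] def grassmannianAction (G : Subgroup (GL (Fin n) F)) (k : ℕ) :
    MulAction G {U : Submodule F (Fin n → F) // Module.finrank F U = k} where
  smul g U := ⟨U.1.map (Matrix.toLin' (g.1 : Matrix (Fin n) (Fin n) F)),
    (finrank_map_toLin' g.1 U.1).trans U.2⟩
  one_smul U := Subtype.ext ((subspaceAction G).one_smul U.1)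
  mul_smul g h U := Subtype.ext ((subspaceAction G).mul_smul g h U.1)

variable [Fintype F]

theorem numClasses_bounds (n : ℕ) : ∃ z g : ℝ, 1 ≤ z ∧ 0 < g ∧
    (∀ k ≤ n, z * qBinom (Fintype.card F) n k ≤ numClassesDim F (MonomialGroup F n) k * g ∧
      numClassesDim F (MonomialGroup F n) k * g ≤
        z * qBinom (Fintype.card F) n k + nonscalarBound (Fintype.card F) n) ∧
    z * Sq (Fintype.card F) n ≤ numClasses F (MonomialGroup F n) * g ∧
      numClasses F (MonomialGroup F n) * g ≤
        z * Sq (Fintype.card F) n + nonscalarBound (Fintype.card F) n := by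
  classical
  have hn : Module.finrank F (Fin n → F) = n := Module.finrank_fin_fun F
  let G := MonomialGroup F n
  have : Fintype G := Fintype.ofFinite _
  choose c hc using fun g : G => exists_isColumnCode g.1 g.2
  let s : Finset G := Finset.univ.filter fun g => ∀ a, nonscalarColumns (c g) a ≠ ∅
  let t : G → ℕ := fun g => Nat.card {U : Submodule F (Fin n → F) //
    U ≤ U.comap (Matrix.toLin' (g.1 : Matrix (Fin n) (Fin n) F))}
  have hst : ((∑ g ∈ s, t g : ℕ) : ℝ) ≤ nonscalarBound (Fintype.card F) n := by
    rw [Nat.cast_sum]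
    exact sum_card_invariant_le s (fun g : G => (g.1 : Matrix (Fin n) (Fin n) F))
      (fun g g' h => Subtype.ext (Units.ext h)) c hc fun g hg => (Finset.mem_filter.1 hg).2
  have hs : ∀ g ∉ s, ∀ U : Submodule F (Fin n → F),
      U.map (Matrix.toLin' (g.1 : Matrix (Fin n) (Fin n) F)) = U := by
    intro g hg U
    have : ∃ a, nonscalarColumns (c g) a = ∅ := by
      simpa [s] using hg
    obtain ⟨a, ha⟩ := this
    refine Submodule.eq_of_le_of_finrank_eq ?_ (finrank_map_toLin' g.1 U)
    rw [(hc g).eq_scalar ha]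
    rintro _ ⟨x, hx, rfl⟩
    exact U.smul_mem a hx
  have hone : (1 : G) ∉ s := by
    intro h
    refine (Finset.mem_filter.1 h).2 1 ?_
    have h1 : IsColumnCode ((1 : GL (Fin n) F) : Matrix (Fin n) (Fin n) F) (c 1) := hc 1
    rw [nonscalarColumns, Finset.filter_eq_empty_iff]
    intro i _
    have h2 := h1.2.2 i
    rw [Units.val_one, Matrix.one_mulVec] at h2
    have h3 := congrFun h2 (c 1 i).1
    have h4 : (c 1 i).1 = i := by
      by_contra hne
      exact h1.2.1 i (by simpa [hne] using h3.symm)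
    rw [not_not]
    refine Prod.ext h4 ?_
    simpa [Pi.single_apply, h4, eq_comm] using h3
  have hlt : s.card < Fintype.card G := Finset.card_lt_univ_of_notMem hone
  refine ⟨(Fintype.card G - s.card : ℕ), Nat.card G, by exact_mod_cast (by omega),
    by exact_mod_cast Nat.card_pos, fun k hk => ?_, ?_⟩
  · let _ := grassmannianAction G k
    have h := card_quot_bounds G {U : Submodule F (Fin n → F) // Module.finrank F U = k} s
      (fun g hg U => Subtype.ext (hs g hg U.1)) t fun g =>
        Nat.card_le_card_of_injective
          (fun U => ⟨U.1.1, Submodule.map_le_iff_le_comap.1 (congrArg Subtype.val U.2).le⟩)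
          fun U U' h => by
            have h := congrArg Subtype.val h
            exact Subtype.ext (Subtype.ext h)
    have hnum : Nat.card (Quot fun x y : {U : Submodule F (Fin n → F) // Module.finrank F U = k} =>
        ∃ g : G, g • x = y) = numClassesDim F G k := by
      unfold numClassesDim
      congr 2
      ext x y
      exact ⟨fun ⟨g, hg⟩ => ⟨g.1, g.2, congrArg Subtype.val hg⟩,
        fun ⟨M, hM, h⟩ => ⟨⟨M, hM⟩, Subtype.ext h⟩⟩
    have hX := card_grassmannian (F := F) (V := Fin n → F) (k := k) (by rwa [hn])
    rw [hn] at hX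
    rw [hnum] at h
    rw [← hX]
    exact ⟨by exact_mod_cast h.1, le_trans (by exact_mod_cast h.2) (add_le_add_right hst _)⟩
  · let _ := subspaceAction G
    have h := card_quot_bounds G (Submodule F (Fin n → F)) s hs t fun g =>
        Nat.card_le_card_of_injective
          (fun U => ⟨U.1, Submodule.map_le_iff_le_comap.1 (show U.1.map _ = U.1 from U.2).le⟩)
          fun U U' h => by
            have h := congrArg Subtype.val h
            exact Subtype.ext h
    have hnum : Nat.card (Quot fun x y : Submodule F (Fin n → F) =>
        ∃ g : G, g • x = y) = numClasses F G := by
      unfold numClasses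
      congr 2
      ext x y
      exact ⟨fun ⟨g, hg⟩ => ⟨g.1, g.2, hg⟩, fun ⟨M, hM, h⟩ => ⟨⟨M, hM⟩, h⟩⟩
    have hX := card_submodule (F := F) (V := Fin n → F)
    rw [hn] at hX
    rw [hnum] at h
    rw [← hX]
    exact ⟨by exact_mod_cast h.1, le_trans (by exact_mod_cast h.2) (add_le_add_right hst _)⟩

end Orbits


/-! ### Asymptotics -/

section Asymptotics

theorem nonscalarBound_nonneg (q n : ℕ) : 0 ≤ nonscalarBound q n := by
  have h : (1 : ℝ) ≤ (1 + n * q * (q : ℝ) ^ (-(n : ℝ) / 120)) ^ n :=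
    one_le_pow₀ (le_add_of_nonneg_right (by positivity))
  have h' := sub_nonneg.2 h
  unfold nonscalarBound
  positivity

theorem tendsto_add_one_mul_pow_self {w : ℕ → ℝ} (hw : Tendsto w atTop (𝓝 0))
    (h0 : ∀ n, 0 ≤ w n) : Tendsto (fun n : ℕ => ((n : ℝ) + 1) * w n ^ n) atTop (𝓝 0) := by
  have h1 : Tendsto (fun n : ℕ => (n : ℝ) ^ 1 * (1 / 2 : ℝ) ^ n + (n : ℝ) ^ 0 * (1 / 2 : ℝ) ^ n)
      atTop (𝓝 (0 + 0)) :=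
    (tendsto_pow_const_mul_const_pow_of_abs_lt_one 1 (by norm_num [abs_of_pos])).add
      (tendsto_pow_const_mul_const_pow_of_abs_lt_one 0 (by norm_num [abs_of_pos]))
  rw [add_zero] at h1
  refine squeeze_zero' (Eventually.of_forall fun n => ?_) ?_ h1
  · have := h0 n
    positivity
  · filter_upwards [hw.eventually_le_const (show (0 : ℝ) < 1 / 2 by norm_num)] with n hn
    calc ((n : ℝ) + 1) * w n ^ n ≤ ((n : ℝ) + 1) * (1 / 2) ^ n := by
          gcongr
          exact h0 n
      _ = _ := by ring

theorem one_add_pow_sub_one_le {x : ℝ} (hx : 0 ≤ x) (n : ℕ) (hnx : n * x ≤ 1) :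
    (1 + x) ^ n - 1 ≤ 2 * (n * x) := by
  have h0 : 0 ≤ n * x := by positivity
  have h1 : (1 + x) ^ n ≤ Real.exp (n * x) := by
    rw [Real.exp_nat_mul]
    exact pow_le_pow_left₀ (by positivity) (by linarith [Real.add_one_le_exp x]) n
  have h2 := Real.abs_exp_sub_one_le (x := n * x) (by rwa [abs_of_nonneg h0])
  rw [abs_of_nonneg h0] at h2
  linarith [le_abs_self (Real.exp (n * x) - 1)]

theorem tendsto_nonscalarBound_div {q : ℕ} (hq : 2 ≤ q) :
    Tendsto (fun n : ℕ => nonscalarBound q n / (q : ℝ) ^ ((n : ℝ) ^ 2 / 4 - n / 240))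
      atTop (𝓝 0) := by
  have hq1 : (1 : ℝ) < q := by exact_mod_cast hq
  have hq0 : (0 : ℝ) < q := by linarith
  set b : ℝ := (q : ℝ) ^ (-(1 / 200) : ℝ) with hb
  set β : ℝ := (q : ℝ) ^ (-(1 / 240) : ℝ) with hβ
  have hb0 : 0 < b := by positivity
  have hβ0 : 0 < β := by positivity
  have hb1 : |b| < 1 := by
    rw [abs_of_pos hb0]
    exact Real.rpow_lt_one_of_one_lt_of_neg hq1 (by norm_num)
  have hβ1 : β < 1 := Real.rpow_lt_one_of_one_lt_of_neg hq1 (by norm_num)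
  have hβ1' : |β| < 1 := by rwa [abs_of_pos hβ0]
  have hββ : |β ^ 2| < 1 := by
    rw [abs_of_pos (by positivity)]
    exact pow_lt_one₀ hβ0.le hβ1 two_ne_zero
  set w : ℕ → ℝ := fun n => q * β⁻¹ * ((n : ℝ) ^ 1 * b ^ n) with hw
  have hw0 : Tendsto w atTop (𝓝 0) := by
    simpa [hw] using (tendsto_pow_const_mul_const_pow_of_abs_lt_one 1 hb1).const_mul (q * β⁻¹)
  have h1 : Tendsto (fun n : ℕ => 8 * (((n : ℝ) + 1) * w n ^ n)) atTop (𝓝 0) := by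
    simpa using (tendsto_add_one_mul_pow_self hw0 fun n => by positivity).const_mul 8
  have h2 : Tendsto (fun n : ℕ => 128 * (q : ℝ) ^ 2 * ((n : ℝ) ^ 4 * β ^ n)) atTop (𝓝 0) := by
    simpa using (tendsto_pow_const_mul_const_pow_of_abs_lt_one 4 hβ1').const_mul
      (128 * (q : ℝ) ^ 2)
  have h3 : Tendsto (fun n : ℕ => (q : ℝ) * ((n : ℝ) ^ 2 * (β ^ 2) ^ n)) atTop (𝓝 0) := by
    simpa using (tendsto_pow_const_mul_const_pow_of_abs_lt_one 2 hββ).const_mul (q : ℝ)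
  have h4 := h1.add h2
  rw [add_zero] at h4
  refine squeeze_zero' (Eventually.of_forall fun n =>
    div_nonneg (nonscalarBound_nonneg q n) (by positivity)) ?_ h4
  filter_upwards [h3.eventually_le_const zero_lt_one, eventually_ge_atTop 1] with n hn hn1
  have hn1' : (1 : ℝ) ≤ n := by exact_mod_cast hn1
  set D : ℝ := (q : ℝ) ^ ((n : ℝ) ^ 2 / 4 - n / 240) with hD
  have hD0 : 0 < D := by positivity
  have hβn : β ^ n = (q : ℝ) ^ (-(1 / 240) * n : ℝ) := by
    rw [hβ, ← Real.rpow_natCast, ← Real.rpow_mul hq0.le]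
  have hbn : (b ^ n) ^ n = (q : ℝ) ^ (-(1 / 200) * n * n : ℝ) := by
    rw [hb, ← Real.rpow_natCast, ← Real.rpow_natCast, ← Real.rpow_mul hq0.le,
      ← Real.rpow_mul hq0.le]
  have e1 : (q : ℝ) ^ (49 / 200 * (n : ℝ) ^ 2) = (b ^ n) ^ n * (β ^ n)⁻¹ * D := by
    rw [hβn, hbn, hD, ← Real.rpow_neg hq0.le, ← Real.rpow_add hq0, ← Real.rpow_add hq0]
    congr 1
    ring
  have e2 : (q : ℝ) ^ ((n : ℝ) ^ 2 / 4) = (β ^ n)⁻¹ * D := by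
    rw [hβn, hD, ← Real.rpow_neg hq0.le, ← Real.rpow_add hq0]
    congr 1
    ring
  have e3 : (q : ℝ) ^ (-(n : ℝ) / 120) = (β ^ 2) ^ n := by
    rw [← pow_mul, mul_comm, pow_mul, hβn, ← Real.rpow_natCast, ← Real.rpow_mul hq0.le]
    congr 1
    push_cast
    ring
  have h5 : (1 + n * q * (β ^ 2) ^ n) ^ n - 1 ≤ 2 * (n * (n * q * (β ^ 2) ^ n)) :=
    one_add_pow_sub_one_le (by positivity) n (by linarith)
  rw [div_le_iff₀ hD0, nonscalarBound, e1, e2, e3, add_mul]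
  gcongr ?_ + ?_
  · refine le_of_eq ?_
    simp only [hw, mul_pow, inv_pow]
    ring
  · have h6 : ((n : ℝ) + 1) ^ 2 ≤ (2 * n) ^ 2 := by gcongr; linarith
    calc (q : ℝ) * (16 * (n + 1) ^ 2 * ((β ^ n)⁻¹ * D) * ((1 + n * q * (β ^ 2) ^ n) ^ n - 1))
        ≤ q * (16 * (2 * n) ^ 2 * ((β ^ n)⁻¹ * D) * (2 * (n * (n * q * (β ^ 2) ^ n)))) := by
          gcongr
          exact sub_nonneg.2 (one_le_pow₀ (le_add_of_nonneg_right (by positivity)))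
      _ = 128 * q ^ 2 * ((n : ℝ) ^ 4 * β ^ n) * D := by
          rw [← pow_mul, mul_comm 2 n, pow_mul]
          field_simp
          ring

theorem abs_div_div_div_sub_one_le {a b g z X S E : ℝ} (hg : 0 < g) (hz : 1 ≤ z) (hX : 0 < X)
    (hXS : X ≤ S) (hE : 0 ≤ E) (ha : z * X ≤ a * g) (ha' : a * g ≤ z * X + E)
    (hb : z * S ≤ b * g) (hb' : b * g ≤ z * S + E) : |a / b / (X / S) - 1| ≤ E / X := by
  have hS : 0 < S := hX.trans_le hXS
  have hz0 : 0 < z := by linarith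
  have hbg : 0 < b * g := (mul_pos hz0 hS).trans_le hb
  have hb0 : 0 < b := pos_of_mul_pos_left hbg hg.le
  have e : a / b / (X / S) = a * g * S / (b * g * X) := by
    field_simp
  rw [e, abs_le]
  constructor
  · rw [neg_le_sub_iff_le_add, ← sub_le_iff_le_add, one_sub_div hX.ne',
      div_le_div_iff₀ hX (by positivity)]
    rcases le_total X E with h | h
    · have : 0 ≤ a * g * S * X := by
        have := (mul_pos hz0 hX).le.trans ha
        positivity
      nlinarith [mul_nonneg (sub_nonneg.2 h) (mul_pos hbg hX).le]
    · have k1 : (X - E) * (b * g) ≤ (X - E) * (z * S + E) :=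
        mul_le_mul_of_nonneg_left hb' (sub_nonneg.2 h)
      have k2 : z * X * S ≤ a * g * S := mul_le_mul_of_nonneg_right ha hS.le
      have k3 : (X - E) * (z * S + E) ≤ z * X * S := by
        have : E * X ≤ E * (z * S) := by
          gcongr
          nlinarith
        nlinarith
      nlinarith
  · rw [sub_le_iff_le_add, div_add_one hX.ne', div_le_div_iff₀ (by positivity) hX]
    have k1 : a * g * S ≤ (z * X + E) * S := mul_le_mul_of_nonneg_right ha' hS.le
    have k2 : (E + X) * (z * S) ≤ (E + X) * (b * g) :=
      mul_le_mul_of_nonneg_left hb (by linarith)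
    have k3 : (z * X + E) * S ≤ (E + X) * (z * S) := by
      nlinarith [mul_nonneg (mul_nonneg hE hS.le) (sub_nonneg.2 hz)]
    nlinarith

end Asymptotics

theorem stmt1 (q : ℕ) (F : Type) [Field F] [Fintype F] (hq : Fintype.card F = q) :
    ∃ A > (0 : ℝ), ∃ ε > (0 : ℝ), ∀ k : ℕ → ℕ, (∀ n, k n ≤ n) → StarCond A ε k →
      Tendsto (fun n : ℕ =>
          ((numClassesDim F (MonomialGroup F n) (k n) : ℝ) /
            (numClasses F (MonomialGroup F n) : ℝ)) /
          (qBinom q n (k n) / Sq q n))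
        atTop (𝓝 1) := by
  subst hq
  have hq : 2 ≤ Fintype.card F := Fintype.one_lt_card
  have hq1 : (1 : ℝ) ≤ Fintype.card F := by exact_mod_cast Fintype.card_pos
  refine ⟨1, one_pos, 1 / 240, by norm_num, fun k hk hstar => ?_⟩
  rw [tendsto_iff_norm_sub_tendsto_zero]
  refine squeeze_zero' (Eventually.of_forall fun n => norm_nonneg _) ?_
    (tendsto_nonscalarBound_div hq)
  filter_upwards [hstar.eventually_le_atBot 0] with n hn
  obtain ⟨z, g, hz, hg, hdim, hall, hall'⟩ := numClasses_bounds (F := F) n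
  obtain ⟨h1, h2⟩ := hdim (k n) (hk n)
  have hE := nonscalarBound_nonneg (Fintype.card F) n
  refine (abs_div_div_div_sub_one_le hg hz (qBinom_pos hq (hk n)) (qBinom_le_Sq hq (hk n))
    hE h1 h2 hall hall').trans ?_
  refine div_le_div_of_nonneg_left hE (by positivity) (le_trans ?_ (pow_le_qBinom hq (hk n)))
  rw [← Real.rpow_natCast _ (k n * (n - k n))]
  refine Real.rpow_le_rpow_of_exponent_le hq1 ?_
  rw [Nat.cast_mul, Nat.cast_sub (hk n)]
  have := Real.sqrt_nonneg n
  linarith
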